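/- Let g be a Lie algebra, ω a nonzero closed 1-form on g, b_ω = ker ω, X ∈ g with ω(X) = 1. There is a short exact sequence of cochain complexes 0 → Λ^{*−1}(b_ω*) → Λ*(g*) → Λ*(b_ω*) → 0, where the first map is c ↦ ω ∧ c, the second is restriction to b_ω, the middle complex carries the deformed differential d_{λω}, the right complex the standard differential d, and the left complex the differential −d. -/

import Mathlib

set_option linter.unusedSectionVars false

namespace CE

variable (K : Type) [Field K] (L : Type) [LieRing L] [LieAlgebra K L]

/-- A function `(Fin q → L) → K` which is multilinear and alternating:
the underlying predicate of the space of Lie algebra `q`-cochains `Λ^q(𝔤*)`. -/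
def IsCochain {q : ℕ} (F : (Fin q → L) → K) : Prop :=
  (∀ (x : Fin q → L) (i : Fin q) (c : K) (u v : L),
      F (Function.update x i (c • u + v)) =
        c * F (Function.update x i u) + F (Function.update x i v)) ∧
  (∀ (x : Fin q → L) (i j : Fin q), i ≠ j → x i = x j → F x = 0)

/-- The space of `q`-cochains `Λ^q(𝔤*)` as a submodule of all functions. -/
def cochain (q : ℕ) : Submodule K ((Fin q → L) → K) where
  carrier := {F | IsCochain K L F}
  add_mem' := by
    rintro F G ⟨hF1, hF2⟩ ⟨hG1, hG2⟩
    refine ⟨fun x i c u v => ?_, fun x i j hij hx => ?_⟩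
    · simp only [Pi.add_apply, hF1, hG1]; ring
    · simp [Pi.add_apply, hF2 x i j hij hx, hG2 x i j hij hx]
  zero_mem' := ⟨fun x i c u v => by simp, fun x i j h hx => rfl⟩
  smul_mem' := by
    rintro c F ⟨h1, h2⟩
    refine ⟨fun x i a u v => ?_, fun x i j hij hx => ?_⟩
    · simp only [Pi.smul_apply, smul_eq_mul, h1]; ring
    · simp [Pi.smul_apply, h2 x i j hij hx]

variable {K L}

/-- The part of the Chevalley–Eilenberg differential coming from the
(one-dimensional) representation `ρ`:
`Σᵢ (−1)ⁱ ρ(xᵢ) F(x₀,…,x̂ᵢ,…,x_q)`. -/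
def term1 (ρ : L →ₗ[K] K) (q : ℕ) (F : (Fin q → L) → K) (x : Fin (q + 1) → L) : K :=
  ∑ i : Fin (q + 1), (-1 : K) ^ (i : ℕ) * ρ (x i) * F (fun k => x (i.succAbove k))

/-- The part of the Chevalley–Eilenberg differential coming from the Lie bracket;
for alternating multilinear `F` it equals
`Σ_{i<j} (−1)^{i+j} F(⁅xᵢ,xⱼ⁆, x₀, …, x̂ᵢ, …, x̂ⱼ, …, x_q)`, here written by
putting `⁅xᵢ,xⱼ⁆` in the slot of `xⱼ` after deleting `xᵢ`. -/
def term2 (q : ℕ) (F : (Fin q → L) → K) (x : Fin (q + 1) → L) : K :=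
  ∑ i : Fin (q + 1), ∑ j : Fin (q + 1),
    if h : i < j then
      (-1 : K) ^ ((i : ℕ) + 1) *
        F (Function.update (fun k => x (i.succAbove k))
            (j.pred (Fin.ne_zero_of_lt h)) ⁅x i, x j⁆)
    else 0

lemma term1_add (ρ : L →ₗ[K] K) (q : ℕ) (F G : (Fin q → L) → K) (x : Fin (q + 1) → L) :
    term1 ρ q (F + G) x = term1 ρ q F x + term1 ρ q G x := by
  unfold term1
  rw [← Finset.sum_add_distrib]
  exact Finset.sum_congr rfl fun i _ => by simp [mul_add]

lemma term1_smul (ρ : L →ₗ[K] K) (q : ℕ) (c : K) (F : (Fin q → L) → K)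
    (x : Fin (q + 1) → L) : term1 ρ q (c • F) x = c * term1 ρ q F x := by
  unfold term1
  rw [Finset.mul_sum]
  exact Finset.sum_congr rfl fun i _ => by simp; ring

lemma term2_add (q : ℕ) (F G : (Fin q → L) → K) (x : Fin (q + 1) → L) :
    term2 q (F + G) x = term2 q F x + term2 q G x := by
  unfold term2
  rw [← Finset.sum_add_distrib]
  refine Finset.sum_congr rfl fun i _ => ?_
  rw [← Finset.sum_add_distrib]
  refine Finset.sum_congr rfl fun j _ => ?_
  by_cases h : i < j
  · simp [h, mul_add]
  · simp [h]

lemma term2_smul (q : ℕ) (c : K) (F : (Fin q → L) → K) (x : Fin (q + 1) → L) :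
    term2 q (c • F) x = c * term2 q F x := by
  unfold term2
  rw [Finset.mul_sum]
  refine Finset.sum_congr rfl fun i _ => ?_
  rw [Finset.mul_sum]
  refine Finset.sum_congr rfl fun j _ => ?_
  by_cases h : i < j
  · simp [h]; ring
  · simp [h]

variable (K L) in
/-- The Chevalley–Eilenberg differential of the Lie algebra `L` with coefficients in the
one-dimensional representation `ρ : L →ₗ[K] K`, as a linear map on raw functions.
On the alternating multilinear functions (`cochain`) it is the usual differential
`(d f)(x₀,…,x_q) = Σᵢ (−1)ⁱ ρ(xᵢ) f(…,x̂ᵢ,…) + Σ_{i<j} (−1)^{i+j} f(⁅xᵢ,xⱼ⁆,…,x̂ᵢ,…,x̂ⱼ,…)`. -/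
def ceD (ρ : L →ₗ[K] K) (q : ℕ) :
    ((Fin q → L) → K) →ₗ[K] ((Fin (q + 1) → L) → K) where
  toFun F := fun x => term1 ρ q F x + term2 q F x
  map_add' F G := by
    funext x
    simp only [term1_add, term2_add, Pi.add_apply]
    ring
  map_smul' c F := by
    funext x
    simp only [term1_smul, term2_smul, Pi.smul_apply, smul_eq_mul, RingHom.id_apply]
    ring

variable (K L)

/-- Cocycles: alternating multilinear functions killed by the CE differential. -/
def cocycles (ρ : L →ₗ[K] K) (q : ℕ) : Submodule K ((Fin q → L) → K) :=
  cochain K L q ⊓ LinearMap.ker (ceD K L ρ q)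

/-- Coboundaries: images of cochains under the CE differential
(intersected with the cocycles; mathematically the image already consists of cocycles). -/
def coboundaries (ρ : L →ₗ[K] K) : (q : ℕ) → Submodule K ((Fin q → L) → K)
  | 0 => ⊥
  | (q + 1) =>
      (Submodule.map (ceD K L ρ q) (cochain K L q)) ⊓ cocycles K L ρ (q + 1)

/-- The Chevalley–Eilenberg cohomology `H^q(L, K_ρ)` of `L` with coefficients in the
one-dimensional representation `ρ : L →ₗ[K] K` (for `ρ = 0`: trivial coefficients). -/
def cohomology (ρ : L →ₗ[K] K) (q : ℕ) : Type _ :=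
  cocycles K L ρ q ⧸ (coboundaries K L ρ q).comap (cocycles K L ρ q).subtype

instance (ρ : L →ₗ[K] K) (q : ℕ) : AddCommGroup (cohomology K L ρ q) :=
  inferInstanceAs (AddCommGroup (_ ⧸ _))

instance (ρ : L →ₗ[K] K) (q : ℕ) : Module K (cohomology K L ρ q) :=
  inferInstanceAs (Module K (_ ⧸ _))

end CE

/-- The kernel of a closed 1-form `ω` as a Lie subalgebra `b_ω ⊆ g`. -/
def bSub (K L : Type) [Field K] [LieRing L] [LieAlgebra K L]
    (ω : L →ₗ[K] K) (hclosed : ∀ x y : L, ω ⁅x, y⁆ = 0) : LieSubalgebra K L :=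
  { LinearMap.ker ω with
    lie_mem' := fun {x y} _ _ => by
      simpa [LinearMap.mem_ker] using hclosed x y }

lemma mem_bSub (K L : Type) [Field K] [LieRing L] [LieAlgebra K L]
    (ω : L →ₗ[K] K) (hclosed : ∀ x y : L, ω ⁅x, y⁆ = 0) (x : L) :
    x ∈ bSub K L ω hclosed ↔ ω x = 0 :=
  LinearMap.mem_ker

namespace CE

section Cochains

variable {K L : Type} [Field K] [LieRing L] [LieAlgebra K L]

/-- A cochain as a bundled alternating map. -/
def IsCochain.toAlternatingMap {q : ℕ} {F : (Fin q → L) → K} (hF : IsCochain K L F) :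
    L [⋀^Fin q]→ₗ[K] K where
  toFun := F
  map_update_add' := by
    intro inst m i x y
    obtain rfl : inst = instDecidableEqFin q := Subsingleton.elim _ _
    simpa using hF.1 m i 1 x y
  map_update_smul' := by
    intro inst m i c x
    obtain rfl : inst = instDecidableEqFin q := Subsingleton.elim _ _
    have h0 : F (Function.update m i 0) = 0 := by simpa using hF.1 m i 1 0 0
    simpa [h0] using hF.1 m i c x 0
  map_eq_zero_of_eq' := fun v i j h hij => hF.2 v i j hij h

@[simp]
lemma IsCochain.toAlternatingMap_apply {q : ℕ} {F : (Fin q → L) → K} (hF : IsCochain K L F)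
    (x : Fin q → L) : hF.toAlternatingMap x = F x := rfl

lemma isCochain_coe {q : ℕ} (f : L [⋀^Fin q]→ₗ[K] K) : IsCochain K L (f : (Fin q → L) → K) :=
  ⟨fun x i c u v => by simp, fun x i j hij h => f.map_eq_zero_of_eq x h hij⟩

lemma IsCochain.comp_linearMap {M : Type} [LieRing M] [LieAlgebra K M] {q : ℕ}
    {F : (Fin q → L) → K} (hF : IsCochain K L F) (g : M →ₗ[K] L) :
    IsCochain K M fun x : Fin q → M => F fun k => g (x k) :=
  isCochain_coe (hF.toAlternatingMap.compLinearMap g)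

/-- A cochain vanishes at `y` as soon as it vanishes after moving `y j` to the front. -/
lemma IsCochain.eq_zero_of_swap {q : ℕ} {F : (Fin (q + 1) → L) → K} (hF : IsCochain K L F)
    (y : Fin (q + 1) → L) (j : Fin (q + 1))
    (h : F (Fin.cons (y j) (Fin.tail (y ∘ Equiv.swap 0 j))) = 0) : F y = 0 := by
  have hy : (Fin.cons (y j) (Fin.tail (y ∘ Equiv.swap 0 j)) : Fin (q + 1) → L)
      = y ∘ Equiv.swap 0 j := by
    conv_rhs => rw [← Fin.cons_self_tail (y ∘ Equiv.swap 0 j)]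
    simp
  rw [hy] at h
  rcases eq_or_ne 0 j with rfl | hj
  · simpa using h
  · have := hF.toAlternatingMap.map_swap y hj
    simp only [IsCochain.toAlternatingMap_apply, h] at this
    exact neg_eq_zero.mp this.symm

/-- Contraction of a form with a vector, in the first slot. -/
def contract {q : ℕ} (x : L) (F : (Fin (q + 1) → L) → K) : (Fin q → L) → K :=
  fun y => F (Fin.cons x y)

lemma IsCochain.contract {q : ℕ} {F : (Fin (q + 1) → L) → K} (hF : IsCochain K L F) (x : L) :
    IsCochain K L (contract x F) := by
  refine ⟨fun y i c u v => ?_, fun y i j hij h => ?_⟩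
  · simp only [CE.contract, Fin.cons_update, hF.1]
  · exact hF.2 _ i.succ j.succ (by simpa using hij) (by simpa using h)

lemma IsCochain.cons_add {q : ℕ} {F : (Fin (q + 1) → L) → K} (hF : IsCochain K L F)
    (c : K) (u v : L) (y : Fin q → L) :
    F (Fin.cons (c • u + v) y) = c * F (Fin.cons u y) + F (Fin.cons v y) := by
  simpa [Fin.update_cons_zero] using hF.1 (Fin.cons 0 y) 0 c u v

lemma isCochain_of_contract {q : ℕ} {G : (Fin (q + 1) → L) → K}
    (hc : ∀ x, IsCochain K L (contract x G))
    (hadd : ∀ (c : K) (u v : L) (y : Fin q → L),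
      G (Fin.cons (c • u + v) y) = c * G (Fin.cons u y) + G (Fin.cons v y))
    (hself : ∀ (y : Fin q → L) (j : Fin q), G (Fin.cons (y j) y) = 0) :
    IsCochain K L G := by
  refine ⟨fun x i c u v => ?_, fun x i j hij h => ?_⟩
  · obtain ⟨x₀, y, rfl⟩ : ∃ x₀ y, x = Fin.cons x₀ y := ⟨_, _, (Fin.cons_self_tail x).symm⟩
    cases i using Fin.cases with
    | zero => simp only [Fin.update_cons_zero, hadd]
    | succ i =>
      simp only [← Fin.cons_update]
      exact (hc x₀).1 y i c u v
  · obtain ⟨x₀, y, rfl⟩ : ∃ x₀ y, x = Fin.cons x₀ y := ⟨_, _, (Fin.cons_self_tail x).symm⟩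
    cases i using Fin.cases with
    | zero =>
      cases j using Fin.cases with
      | zero => exact absurd rfl hij
      | succ j =>
        simp only [Fin.cons_zero, Fin.cons_succ] at h
        rw [h]
        exact hself y j
    | succ i =>
      cases j using Fin.cases with
      | zero =>
        simp only [Fin.cons_zero, Fin.cons_succ] at h
        rw [← h]
        exact hself y i
      | succ j => exact (hc x₀).2 y i j (by simpa using hij) (by simpa using h)

/-- The Lie derivative of a form along a vector (trivial coefficients). -/
def lieDer {q : ℕ} (x : L) (F : (Fin q → L) → K) : (Fin q → L) → K :=
  fun y => -∑ j : Fin q, F (Function.update y j ⁅x, y j⁆)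

lemma IsCochain.lieDer {q : ℕ} {F : (Fin q → L) → K} (hF : IsCochain K L F) (x : L) :
    IsCochain K L (lieDer x F) := by
  refine ⟨fun y i c u v => ?_, fun y i j hij h => ?_⟩
  · have key : ∀ (w : L) (j : Fin q),
        F (Function.update (Function.update y i w) j ⁅x, Function.update y i w j⁆)
          = if j = i then F (Function.update y i ⁅x, w⁆)
            else F (Function.update (Function.update y j ⁅x, y j⁆) i w) := by
      intro w j
      split_ifs with hji
      · subst hji; simp
      · rw [Function.update_comm (Ne.symm hji), Function.update_of_ne hji]
    simp only [CE.lieDer, key]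
    rw [mul_neg, ← neg_add, Finset.mul_sum, ← Finset.sum_add_distrib]
    refine congrArg _ (Finset.sum_congr rfl fun j _ => ?_)
    split_ifs with hji
    · rw [lie_add, lie_smul, hF.1]
    · rw [hF.1]
  · simp only [CE.lieDer, neg_eq_zero]
    rw [Fintype.sum_eq_add i j hij]
    · have hsw : Function.update y j ⁅x, y j⁆
          = Function.update y i ⁅x, y i⁆ ∘ Equiv.swap i j := by
        funext k
        rcases eq_or_ne k i with rfl | hki
        · simp [hij, hij.symm, h]
        rcases eq_or_ne k j with rfl | hkj
        · simp [h]
        · simp [Equiv.swap_apply_of_ne_of_ne hki hkj, hki, hkj]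
      rw [hsw, add_comm]
      exact hF.toAlternatingMap.map_swap_add _ hij
    · rintro k ⟨hki, hkj⟩
      exact hF.2 _ i j hij (by simp [hki.symm, hkj.symm, h])

lemma lieDer_add {q : ℕ} {F : (Fin q → L) → K} (hF : IsCochain K L F) (c : K) (u v : L)
    (y : Fin q → L) : lieDer (c • u + v) F y = c * lieDer u F y + lieDer v F y := by
  simp only [lieDer, add_lie, smul_lie, hF.1]
  rw [Finset.sum_add_distrib, ← Finset.mul_sum]
  ring

lemma lieDer_cons {q : ℕ} (x u : L) (F : (Fin (q + 1) → L) → K) (y : Fin q → L) :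
    lieDer x F (Fin.cons u y) = -F (Fin.cons ⁅x, u⁆ y) + lieDer x (contract u F) y := by
  simp only [lieDer, contract, Fin.sum_univ_succ, Fin.cons_zero, Fin.cons_succ,
    Fin.update_cons_zero, Fin.cons_update]
  ring

lemma ceD_zero_apply (ρ : L →ₗ[K] K) (F : (Fin 0 → L) → K) (x : L) (y : Fin 0 → L) :
    ceD K L ρ 0 F (Fin.cons x y) = ρ x * F y := by
  simp [ceD, term1, term2, Subsingleton.elim _ y]

/-- Cartan's formula. -/
lemma ceD_cons (ρ : L →ₗ[K] K) (q : ℕ) (F : (Fin (q + 1) → L) → K) (x : L)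
    (y : Fin (q + 1) → L) :
    ceD K L ρ (q + 1) F (Fin.cons x y)
      = ρ x * F y + lieDer x F y - ceD K L ρ q (contract x F) y := by
  have h1 : term1 ρ (q + 1) F (Fin.cons x y) = ρ x * F y - term1 ρ q (contract x F) y := by
    simp only [term1]
    rw [Fin.sum_univ_succ, sub_eq_add_neg, ← Finset.sum_neg_distrib]
    congr 1
    · simp
    · refine Finset.sum_congr rfl fun i _ => ?_
      have : (fun k => (Fin.cons x y : Fin (q + 2) → L) (i.succ.succAbove k))
          = Fin.cons x fun k => y (i.succAbove k) := by
        funext k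
        cases k using Fin.cases <;> simp
      rw [this]
      simp [contract, pow_succ]
  have h2 : term2 (q + 1) F (Fin.cons x y) = lieDer x F y - term2 q (contract x F) y := by
    simp only [term2]
    rw [Fin.sum_univ_succ, sub_eq_add_neg, ← Finset.sum_neg_distrib]
    congr 1
    · rw [Fin.sum_univ_succ]
      simp [lieDer]
    · refine Finset.sum_congr rfl fun i _ => ?_
      rw [Fin.sum_univ_succ, ← Finset.sum_neg_distrib, dif_neg (by simp), zero_add]
      refine Finset.sum_congr rfl fun j _ => ?_
      by_cases hij : i < j
      · rw [dif_pos hij, dif_pos (by simpa using hij)]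
        have : (fun k => (Fin.cons x y : Fin (q + 2) → L) (i.succ.succAbove k))
            = Fin.cons x fun k => y (i.succAbove k) := by
          funext k
          cases k using Fin.cases <;> simp
        rw [this]
        obtain ⟨j', rfl⟩ := Fin.exists_succ_eq.mpr (Fin.ne_zero_of_lt hij)
        simp [contract, pow_succ, Fin.cons_update]
      · rw [dif_neg hij, dif_neg (by simpa using hij), neg_zero]
  simp only [ceD, LinearMap.coe_mk, AddHom.coe_mk, h1, h2]
  ring

lemma ceD_contract_add (ρ : L →ₗ[K] K) {q : ℕ} {F : (Fin (q + 1) → L) → K}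
    (hF : IsCochain K L F) (c : K) (u v : L) (y : Fin (q + 1) → L) :
    ceD K L ρ q (contract (c • u + v) F) y
      = c * ceD K L ρ q (contract u F) y + ceD K L ρ q (contract v F) y := by
  have : contract (c • u + v) F = c • contract u F + contract v F := by
    funext y
    simp [contract, hF.cons_add]
  rw [this, map_add, map_smul]
  rfl

/-- The Chevalley–Eilenberg differential maps cochains to cochains. -/
lemma IsCochain.ceD (ρ : L →ₗ[K] K) {q : ℕ} {F : (Fin q → L) → K} (hF : IsCochain K L F) :
    IsCochain K L (ceD K L ρ q F) := by
  induction q with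
  | zero =>
    refine isCochain_of_contract (fun x => ⟨fun _ i => i.elim0, fun _ i => i.elim0⟩)
      (fun c u v y => ?_) fun _ j => j.elim0
    simp only [ceD_zero_apply, map_add, map_smul, smul_eq_mul]
    ring
  | succ q ih =>
    have hcontract : ∀ x, IsCochain K L (CE.contract x (CE.ceD K L ρ (q + 1) F)) := by
      intro x
      have : CE.contract x (CE.ceD K L ρ (q + 1) F)
          = ρ x • F + CE.lieDer x F - CE.ceD K L ρ q (CE.contract x F) :=
        funext fun y => ceD_cons ρ q F x y
      rw [this]
      exact Submodule.sub_mem (cochain K L (q + 1))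
        (Submodule.add_mem _ (Submodule.smul_mem _ _ hF) (hF.lieDer x)) (ih (hF.contract x))
    refine isCochain_of_contract hcontract (fun c u v y => ?_) fun y j => ?_
    · simp only [ceD_cons, map_add, map_smul, smul_eq_mul, lieDer_add hF,
        ceD_contract_add ρ hF]
      ring
    · refine (hcontract (y j)).eq_zero_of_swap y j ?_
      generalize y j = x, Fin.tail (y ∘ Equiv.swap 0 j) = z
      have hx : F (Fin.cons x z) = CE.contract x F z := rfl
      have h0 : F (Fin.cons 0 z) = 0 :=
        hF.toAlternatingMap.map_coord_zero 0 (by simp)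
      change CE.ceD K L ρ (q + 1) F (Fin.cons x (Fin.cons x z)) = 0
      rw [ceD_cons, lieDer_cons, lie_self, h0, neg_zero, zero_add, hx]
      cases q with
      | zero =>
        rw [ceD_zero_apply]
        simp [CE.lieDer]
      | succ q =>
        have hxx : CE.contract x (CE.contract x F) = 0 :=
          funext fun w => hF.2 _ 0 (Fin.succ 0) (Fin.succ_ne_zero 0).symm
            (by simp only [Fin.cons_zero, Fin.cons_succ])
        rw [ceD_cons, hxx, map_zero, Pi.zero_apply]
        ring

/-- A cochain vanishes if it vanishes on tuples from a set `S` such that every vector has the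
form `c • u + v` with `u, v ∈ S`. -/
lemma IsCochain.eq_zero_of_span (S : Set L)
    (hS : ∀ x : L, ∃ c : K, ∃ u ∈ S, ∃ v ∈ S, x = c • u + v)
    {q : ℕ} {F : (Fin q → L) → K} (hF : IsCochain K L F)
    (h : ∀ x, (∀ i, x i ∈ S) → F x = 0) : F = 0 := by
  induction q with
  | zero => exact funext fun x => h x fun i => i.elim0
  | succ q ih =>
    have hu : ∀ u ∈ S, CE.contract u F = 0 := fun u hu =>
      ih (hF.contract u) fun x hx => h _ (Fin.cases (by simpa using hu) (by simpa using hx))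
    funext x
    obtain ⟨c, u, huS, v, hvS, hx⟩ := hS (x 0)
    have hFu : F (Fin.cons u (Fin.tail x)) = 0 := congrFun (hu u huS) _
    have hFv : F (Fin.cons v (Fin.tail x)) = 0 := congrFun (hu v hvS) _
    rw [← Fin.cons_self_tail x, hx, hF.cons_add, hFu, hFv]
    simp

end Cochains

section KernelOfClosedForm

variable {K L : Type} [Field K] [LieRing L] [LieAlgebra K L]
  (ω : L →ₗ[K] K) (hclosed : ∀ x y : L, ω ⁅x, y⁆ = 0)

/-- The projection `y ↦ y - ω(y) X` of `L` onto `ker ω`. -/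
def proj (X : L) (hX : ω X = 1) : L →ₗ[K] bSub K L ω hclosed where
  toFun y := ⟨y - ω y • X, (mem_bSub K L ω hclosed _).mpr (by simp [hX])⟩
  map_add' x y := Subtype.ext <| by
    change x + y - ω (x + y) • X = (x - ω x • X) + (y - ω y • X)
    rw [map_add, add_smul]
    abel
  map_smul' c x := Subtype.ext <| by
    simp [smul_sub, mul_smul]

/-- Restriction of forms to `ker ω`. -/
def restrict {r : ℕ} (f : (Fin r → L) → K) : (Fin r → bSub K L ω hclosed) → K :=
  fun w => f fun k => (w k : L)

/-- The map `c ↦ ω ∧ c` from forms on `ker ω` to forms on `L`. -/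
def wedge (X : L) (hX : ω X = 1) {r : ℕ} (c : (Fin r → bSub K L ω hclosed) → K) :
    (Fin (r + 1) → L) → K :=
  fun x => ∑ i : Fin (r + 1),
    (-1 : K) ^ (i : ℕ) * ω (x i) * c fun k => proj ω hclosed X hX (x (i.succAbove k))

variable {ω}

lemma form_coe (b : bSub K L ω hclosed) : ω (b : L) = 0 :=
  (mem_bSub K L ω hclosed _).mp b.2

variable {hclosed} {X : L} (hX : ω X = 1)

@[simp]
lemma proj_coe (b : bSub K L ω hclosed) : proj ω hclosed X hX (b : L) = b :=
  Subtype.ext <| by simp [proj, form_coe hclosed b]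

lemma isCochain_wedge {q : ℕ} {c : (Fin q → bSub K L ω hclosed) → K}
    (hc : IsCochain K (bSub K L ω hclosed) c) :
    IsCochain K L (wedge ω hclosed X hX c) := by
  have hf := isCochain_coe (AlternatingMap.alternatizeUncurryFin
    (ω.smulRight (hc.toAlternatingMap.compLinearMap (proj ω hclosed X hX))))
  convert hf using 1
  funext x
  simp only [wedge, AlternatingMap.alternatizeUncurryFin_apply]
  refine Finset.sum_congr rfl fun i _ => ?_
  simp [mul_assoc, Fin.removeNth, zsmul_eq_mul]

lemma restrict_wedge {q : ℕ} (c : (Fin q → bSub K L ω hclosed) → K) :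
    restrict ω hclosed (wedge ω hclosed X hX c) = 0 :=
  by
  funext w
  simp [restrict, wedge, form_coe]

lemma restrict_contract_wedge {q : ℕ} (c : (Fin q → bSub K L ω hclosed) → K) :
    restrict ω hclosed (contract X (wedge ω hclosed X hX c)) = c := by
  funext w
  simp [restrict, contract, wedge, Fin.sum_univ_succ, form_coe, hX]

lemma isCochain_restrict {q : ℕ} {f : (Fin q → L) → K} (hf : IsCochain K L f) :
    IsCochain K (bSub K L ω hclosed) (restrict ω hclosed f) :=
  hf.comp_linearMap ((bSub K L ω hclosed).incl : bSub K L ω hclosed →ₗ[K] L)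

/-- Restriction to `ker ω` commutes with the differentials. -/
lemma restrict_ceD (l : K) (q : ℕ) (f : (Fin q → L) → K) :
    restrict ω hclosed (ceD K L (l • ω) q f)
      = ceD K (bSub K L ω hclosed) 0 q (restrict ω hclosed f) := by
  funext w
  have h1 : term1 (l • ω) q f (fun k => (w k : L)) = 0 :=
    Finset.sum_eq_zero fun i _ => by simp [form_coe]
  have h2 : term1 (0 : bSub K L ω hclosed →ₗ[K] K) q (restrict ω hclosed f) w = 0 :=
    Finset.sum_eq_zero fun i _ => by simp
  have h3 : term2 q f (fun k => (w k : L)) = term2 q (restrict ω hclosed f) w := by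
    refine Finset.sum_congr rfl fun i _ => Finset.sum_congr rfl fun j _ => ?_
    split_ifs with hij
    · simp only [restrict]
      congr 2
      funext k
      rcases eq_or_ne k (j.pred (Fin.ne_zero_of_lt hij)) with rfl | hk
      · simp
      · simp [hk]
    · rfl
  change term1 _ q f _ + term2 q f _ = term1 _ q _ w + term2 q _ w
  rw [h1, h2, h3]

/-- A cochain of positive degree vanishes if its restriction to `ker ω` and the restriction of its
contraction with `X` vanish. -/
lemma IsCochain.eq_zero_of_restrict {q : ℕ} {F : (Fin (q + 1) → L) → K} (hX : ω X = 1)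
    (hF : IsCochain K L F) (h : restrict ω hclosed F = 0)
    (hFX : restrict ω hclosed (CE.contract X F) = 0) : F = 0 := by
  refine hF.eq_zero_of_span {x | ω x = 0 ∨ x = X}
    (fun x => ⟨ω x, X, Or.inr rfl, x - ω x • X, Or.inl (by simp [hX]), by simp⟩) fun x hx => ?_
  by_cases hex : ∃ j, x j = X
  · obtain ⟨j, hj⟩ := hex
    refine hF.eq_zero_of_swap x j ?_
    rw [hj]
    by_cases hex' : ∃ k, Fin.tail (x ∘ Equiv.swap 0 j) k = X
    · obtain ⟨k, hk⟩ := hex'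
      exact hF.2 _ 0 k.succ (Fin.succ_ne_zero k).symm (by simp [hk])
    · push Not at hex'
      exact congrFun hFX fun k => ⟨Fin.tail (x ∘ Equiv.swap 0 j) k,
        (mem_bSub K L ω hclosed _).mpr ((hx (Equiv.swap 0 j k.succ)).resolve_right (hex' k))⟩
  · push Not at hex
    exact congrFun h fun k => ⟨x k, (mem_bSub K L ω hclosed _).mpr ((hx k).resolve_right (hex k))⟩

lemma IsCochain.eq_of_restrict {q : ℕ} {F G : (Fin (q + 1) → L) → K} (hX : ω X = 1)
    (hF : IsCochain K L F) (hG : IsCochain K L G)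
    (h : restrict ω hclosed F = restrict ω hclosed G)
    (hFX : restrict ω hclosed (CE.contract X F) = restrict ω hclosed (CE.contract X G)) :
    F = G :=
  sub_eq_zero.mp <| IsCochain.eq_zero_of_restrict hX (Submodule.sub_mem (cochain K L (q + 1)) hF hG)
    (funext fun w => sub_eq_zero.mpr (congrFun h w))
    (funext fun w => sub_eq_zero.mpr (congrFun hFX w))

/-- `c ↦ ω ∧ c` intertwines `-d` and the deformed differential. -/
lemma ceD_wedge (l : K) {q : ℕ} {c : (Fin q → bSub K L ω hclosed) → K}
    (hc : IsCochain K (bSub K L ω hclosed) c) :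
    ceD K L (l • ω) (q + 1) (wedge ω hclosed X hX c)
      = wedge ω hclosed X hX (-ceD K (bSub K L ω hclosed) 0 q c) := by
  have hW := isCochain_wedge hX hc
  refine IsCochain.eq_of_restrict (hclosed := hclosed) hX (hW.ceD _)
    (isCochain_wedge hX (Submodule.neg_mem (cochain K _ (q + 1)) (hc.ceD 0))) ?_ ?_
  · rw [restrict_ceD, restrict_wedge, restrict_wedge, map_zero]
  · rw [restrict_contract_wedge]
    funext w
    have h1 : wedge ω hclosed X hX c (fun k => (w k : L)) = 0 :=
      congrFun (restrict_wedge hX c) w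
    have h2 : lieDer X (wedge ω hclosed X hX c) (fun k => (w k : L)) = 0 := by
      refine neg_eq_zero.mpr (Finset.sum_eq_zero fun j _ => Finset.sum_eq_zero fun i _ => ?_)
      have : ω (Function.update (fun k => (w k : L)) j ⁅X, (w j : L)⁆ i) = 0 := by
        rcases eq_or_ne i j with rfl | hij
        · simp [hclosed]
        · simp [hij, form_coe]
      rw [this, mul_zero, zero_mul]
    have h3 : ceD K L (l • ω) q (contract X (wedge ω hclosed X hX c)) (fun k => (w k : L))
        = ceD K (bSub K L ω hclosed) 0 q c w := by
      have := congrFun (restrict_ceD (hclosed := hclosed) l q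
        (contract X (wedge ω hclosed X hX c))) w
      rwa [restrict_contract_wedge] at this
    change ceD K L (l • ω) (q + 1) _ (Fin.cons X _) = _
    rw [ceD_cons, h1, h2, h3]
    simp

end KernelOfClosedForm

end CE

/-- Let `g` be a Lie algebra, `ω` a nonzero closed 1-form, `b_ω = ker ω`,
`X ∈ g` with `ω(X) = 1`.  There is a short exact sequence of cochain complexes
`0 → Λ^{*−1}(b_ω*) → Λ*(g*) → Λ*(b_ω*) → 0`, where the first map is `c ↦ ω ∧ c`
(extending `c` to `g` by the projection `y ↦ y − ω(y)X`), the second map is restriction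
to `b_ω`, the middle complex carries the deformed differential `d_{λω}`, the right complex
the standard differential `d`, and the left complex the differential `−d`. -/
theorem stmt12 (K L : Type) [Field K] [LieRing L] [LieAlgebra K L]
    (ω : L →ₗ[K] K) (hclosed : ∀ x y : L, ω ⁅x, y⁆ = 0) (hω : ω ≠ 0)
    (X : L) (hX : ω X = 1) (l : K) (q : ℕ) :
    let B := bSub K L ω hclosed
    let π : L → ↥B := fun y =>
      ⟨y - ω y • X, (mem_bSub K L ω hclosed _).mpr (by simp [hX])⟩
    -- restriction of forms to `b_ω`
    let res : ∀ {r : ℕ}, ((Fin r → L) → K) → ((Fin r → ↥B) → K) :=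
      fun {r} f w => f fun k => (w k : L)
    -- the map `c ↦ ω ∧ c` of forms on `b_ω` to forms on `g`
    let W : ∀ {r : ℕ}, ((Fin r → ↥B) → K) → ((Fin (r + 1) → L) → K) :=
      fun {r} c x => ∑ i : Fin (r + 1),
        (-1 : K) ^ (i : ℕ) * ω (x i) * c fun k => π (x (i.succAbove k))
    -- `W` is injective on cochains and lands in cochains
    (∀ c ∈ CE.cochain K (↥B) q, W c ∈ CE.cochain K L (q + 1) ∧ (W c = 0 → c = 0)) ∧
    -- restriction maps cochains onto cochains
    (∀ f ∈ CE.cochain K L (q + 1), res f ∈ CE.cochain K (↥B) (q + 1)) ∧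
    (∀ c' ∈ CE.cochain K (↥B) (q + 1),
      ∃ f ∈ CE.cochain K L (q + 1), res f = c') ∧
    -- exactness in the middle
    (∀ f ∈ CE.cochain K L (q + 1),
      (res f = 0 ↔ ∃ c ∈ CE.cochain K (↥B) q, W c = f)) ∧
    -- `c ↦ ω ∧ c` is a chain map from `(Λ^{*−1}(b_ω*), −d)` to `(Λ*(g*), d_{λω})`
    (∀ c ∈ CE.cochain K (↥B) q,
      CE.ceD K L (l • ω) (q + 1) (W c)
        = W (-(CE.ceD K (↥B) (0 : ↥B →ₗ[K] K) q c))) ∧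
    -- restriction is a chain map from `(Λ*(g*), d_{λω})` to `(Λ*(b_ω*), d)`
    (∀ f : (Fin (q + 1) → L) → K, f ∈ CE.cochain K L (q + 1) →
      res (CE.ceD K L (l • ω) (q + 1) f)
        = CE.ceD K (↥B) (0 : ↥B →ₗ[K] K) (q + 1) (res f)) := by
  intro B π res W
  refine ⟨fun c hc => ⟨CE.isCochain_wedge hX hc, fun h => ?_⟩, fun f hf => CE.isCochain_restrict hf,
    fun c' hc' => ⟨fun x => c' fun k => CE.proj ω hclosed X hX (x k), CE.IsCochain.comp_linearMap hc' (CE.proj ω hclosed X hX), ?_⟩,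
    fun f hf => ⟨fun h => ⟨CE.restrict ω hclosed (CE.contract X f),
      CE.isCochain_restrict (hf.contract X), ?_⟩, ?_⟩,
    fun c hc => CE.ceD_wedge hX l hc, fun f _ => CE.restrict_ceD l (q + 1) f⟩
  · have h' : CE.wedge ω hclosed X hX c = 0 := h
    rw [← CE.restrict_contract_wedge hX c, h']
    rfl
  · funext w
    simp [res]
  · have hf' := CE.isCochain_restrict (hclosed := hclosed) (CE.IsCochain.contract hf X)
    exact CE.IsCochain.eq_of_restrict hX (CE.isCochain_wedge hX hf') hf
      ((CE.restrict_wedge hX _).trans h.symm) (CE.restrict_contract_wedge hX _)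
  · rintro ⟨c, -, rfl⟩
    exact CE.restrict_wedge hX c
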